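/- arXiv:1904.02212 — 6 statements merged into one kernel-verified Lean document; each statement's English description precedes it below -/
import Mathlib

section
/- Fix d ≥ 3 and c ∈ (0,1). Let B(n) be the set of graphs in G_{d,c}(n) having at least (log log n / log n)·n bad vertices. Then |B(n)| / |G_{d,c}(n)| → 0 as n → ∞ along integers n with n·d even. In particular, with high probability a uniformly random element of G_{d,c}(n) has fewer than (log log n / log n)·n bad vertices. -/
open Filter

/-- The number of `k`-cliques (sets of `k` mutually adjacent vertices) in a graph. -/
noncomputable def cliqueCount {V : Type*} (G : SimpleGraph V) (k : ℕ) : ℕ :=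
  Nat.card {t : Finset V // G.IsNClique k t}

/-- A graph is `d`-regular: every vertex has degree exactly `d`. -/
def IsDRegular {V : Type*} (G : SimpleGraph V) (d : ℕ) : Prop :=
  ∀ v : V, (G.neighborSet v).ncard = d

/-- `G_{d,c}(n)`: the set of simple `d`-regular graphs on the labeled vertex set `Fin n`
with at least `c * T_max` triangles, where `T_max = (n/3) * choose d 2`. -/
noncomputable def Gdc (n d : ℕ) (c : ℝ) : Set (SimpleGraph (Fin n)) :=
  {G | IsDRegular G d ∧ c * ((n : ℝ) / 3 * (d.choose 2)) ≤ (cliqueCount G 3 : ℝ)}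

/-- A vertex is bad if it is contained in a triangle but in no clique on `d+1` vertices. -/
def BadVertex {V : Type*} (G : SimpleGraph V) (d : ℕ) (v : V) : Prop :=
  (∃ t : Finset V, G.IsNClique 3 t ∧ v ∈ t) ∧
    ¬∃ s : Finset V, G.IsNClique (d + 1) s ∧ v ∈ s

/-- The number of bad vertices of a graph. -/
noncomputable def badVertexCount {V : Type*} (G : SimpleGraph V) (d : ℕ) : ℕ :=
  Nat.card {v : V // BadVertex G d v}

/-- A port numbering of a `d`-regular graph: `nbr v` lists the neighbours of `v` without
repetition. -/
structure IsPorts {V : Type*} {d : ℕ} (G : SimpleGraph V) (nbr : V → Fin d → V) : Prop where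
  inj : ∀ v, Function.Injective (nbr v)
  adj_iff : ∀ v w, G.Adj v w ↔ ∃ i, nbr v i = w

lemma IsPorts.adj {V : Type*} {d : ℕ} {G : SimpleGraph V} {nbr : V → Fin d → V}
    (h : IsPorts G nbr) (v : V) (i : Fin d) : G.Adj v (nbr v i) :=
  (h.adj_iff v _).2 ⟨i, rfl⟩

lemma IsPorts.isDRegular {V : Type*} {d : ℕ} {G : SimpleGraph V} {nbr : V → Fin d → V}
    (h : IsPorts G nbr) : IsDRegular G d := by
  intro v
  have : G.neighborSet v = Set.range (nbr v) := by
    ext w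
    simp [h.adj_iff]
  rw [this, ← Set.image_univ, Set.ncard_image_of_injective _ (h.inj v), Set.ncard_univ]
  simp

lemma IsDRegular.exists_isPorts {V : Type*} [Finite V] {d : ℕ} {G : SimpleGraph V}
    (h : IsDRegular G d) : ∃ nbr : V → Fin d → V, IsPorts G nbr := by
  have key : ∀ v, Nonempty (Fin d ≃ G.neighborSet v) := by
    intro v
    have e := Finite.equivFinOfCardEq (α := G.neighborSet v) (n := d)
      (by rw [Nat.card_coe_set_eq]; exact h v)
    exact ⟨e.symm⟩
  have e := fun v => (key v).some
  refine ⟨fun v i => (e v i : V), fun v i j hij => (e v).injective (Subtype.ext hij), ?_⟩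
  intro v w
  constructor
  · intro hw
    exact ⟨(e v).symm ⟨w, hw⟩, by simp⟩
  · rintro ⟨i, rfl⟩
    exact (e v i).2

/-- Each element of `S` is the first one of `S` in a uniformly random order with the same
frequency. -/
lemma card_mul_card_perm_min {V : Type*} [Fintype V] [LinearOrder V] (S : Finset V) {s : V}
    (hs : s ∈ S) :
    S.card * (Finset.univ.filter fun σ : Equiv.Perm V => ∀ w ∈ S, σ s ≤ σ w).card =
      (Fintype.card V).factorial := by
  have h1 : ∀ t ∈ S, (Finset.univ.filter fun σ : Equiv.Perm V => ∀ w ∈ S, σ t ≤ σ w).card =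
      (Finset.univ.filter fun σ : Equiv.Perm V => ∀ w ∈ S, σ s ≤ σ w).card := by
    intro t ht
    refine Finset.card_bij' (fun σ _ => σ * Equiv.swap s t) (fun σ _ => σ * Equiv.swap s t)
      ?_ ?_ ?_ ?_
    · intro σ hσ
      simp only [Finset.mem_filter, Finset.mem_univ, true_and, Equiv.Perm.mul_apply,
        Equiv.swap_apply_left] at hσ ⊢
      intro w hw
      apply hσ
      rw [Equiv.swap_apply_def]; split_ifs <;> assumption
    · intro σ hσ
      simp only [Finset.mem_filter, Finset.mem_univ, true_and, Equiv.Perm.mul_apply,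
        Equiv.swap_apply_right] at hσ ⊢
      intro w hw
      apply hσ
      rw [Equiv.swap_apply_def]; split_ifs <;> assumption
    · intro σ _
      simp [mul_assoc]
    · intro σ _
      simp [mul_assoc]
  calc S.card * (Finset.univ.filter fun σ : Equiv.Perm V => ∀ w ∈ S, σ s ≤ σ w).card
      = ∑ t ∈ S, (Finset.univ.filter fun σ : Equiv.Perm V => ∀ w ∈ S, σ t ≤ σ w).card := by
        rw [Finset.sum_congr rfl h1, Finset.sum_const, smul_eq_mul]
    _ = ∑ σ : Equiv.Perm V, (S.filter fun t => ∀ w ∈ S, σ t ≤ σ w).card := by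
        simp only [Finset.card_filter]
        exact Finset.sum_comm
    _ = ∑ σ : Equiv.Perm V, 1 := by
        refine Finset.sum_congr rfl fun σ _ => ?_
        obtain ⟨m, hm, hmin⟩ := S.exists_min_image σ ⟨s, hs⟩
        rw [Finset.card_eq_one]
        refine ⟨m, ?_⟩
        ext t
        simp only [Finset.mem_filter, Finset.mem_singleton]
        constructor
        · rintro ⟨ht, h⟩
          exact σ.injective (le_antisymm (h m hm) (hmin t ht))
        · rintro rfl
          exact ⟨hm, hmin⟩
    _ = (Fintype.card V).factorial := by
        simp [Fintype.card_perm]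

/-- The vertex relation decoded from a list `E` of darts with explicit targets `g`, the ports `rev`
of the reversed darts, and the shortcuts `sc` that describe a dart as a path of two darts. -/
inductive Decodes {V : Type*} {d : ℕ} (E : Finset (V × Fin d)) (g : E → V)
    (rev : V × Fin d → Fin d) (sc : V × Fin d → Option (Fin d × Fin d)) :
    V → Fin d → V → Prop
  | fwd (p : E) : Decodes E g rev sc p.1.1 p.1.2 (g p)
  | bwd (p : E) : Decodes E g rev sc (g p) (rev p) p.1.1
  | step (v : V) (i j k : Fin d) (x w : V) (h : sc (v, i) = some (j, k))
      (hx : Decodes E g rev sc v j x) (hw : Decodes E g rev sc x k w) :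
      Decodes E g rev sc v i w

/-- The data from which a `d`-regular graph with at most `M` explicit darts is recovered. -/
abbrev GraphCode (V : Type*) (d M : ℕ) : Type _ :=
  (Σ E : {E : Finset (V × Fin d) // E.card ≤ M}, (E.1 → V)) ×
    (V × Fin d → Fin d) × (V × Fin d → Option (Fin d × Fin d))

/-- The graph described by a code. -/
def GraphCode.graph {V : Type*} {d M : ℕ} (c : GraphCode V d M) : SimpleGraph V :=
  SimpleGraph.fromRel fun v w => ∃ i, Decodes c.1.1.1 c.1.2 c.2.1 c.2.2 v i w

/-- The darts that start at the first vertex among their ends and the common neighbours. -/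
noncomputable def explicitDarts {V : Type*} [Fintype V] [LinearOrder V] {d : ℕ}
    (G : SimpleGraph V) (nbr : V → Fin d → V) (σ : Equiv.Perm V) : Finset (V × Fin d) :=
  open Classical in
  Finset.univ.filter fun p => ∀ w ∈ insert p.1 (insert (nbr p.1 p.2)
    (Finset.univ.filter fun x => G.Adj p.1 x ∧ G.Adj (nbr p.1 p.2) x)), σ p.1 ≤ σ w

lemma exists_graphCode {V : Type*} [Fintype V] [LinearOrder V] {d M : ℕ}
    {G : SimpleGraph V} {nbr : V → Fin d → V} (hp : IsPorts G nbr) (σ : Equiv.Perm V)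
    (hM : (explicitDarts G nbr σ).card ≤ M) : ∃ c : GraphCode V d M, c.graph = G := by
  classical
  have hrev : ∀ p : V × Fin d, ∃ i, nbr (nbr p.1 p.2) i = p.1 := fun p =>
    (hp.adj_iff _ _).1 (hp.adj p.1 p.2).symm
  choose rev hrev using hrev
  have hsc : ∀ p : V × Fin d, ∃ o : Option (Fin d × Fin d),
      (∀ q ∈ o, nbr (nbr p.1 q.1) q.2 = nbr p.1 p.2 ∧ σ (nbr p.1 q.1) < σ p.1 ∧
        σ (nbr p.1 q.1) < σ (nbr p.1 p.2)) ∧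
      (o = none → ∀ x, G.Adj p.1 x → G.Adj (nbr p.1 p.2) x → σ x < σ p.1 →
        ¬ σ x < σ (nbr p.1 p.2)) := by
    intro p
    by_cases h : ∃ x, G.Adj p.1 x ∧ G.Adj (nbr p.1 p.2) x ∧ σ x < σ p.1 ∧ σ x < σ (nbr p.1 p.2)
    · obtain ⟨x, h1, h2, h3, h4⟩ := h
      obtain ⟨j, rfl⟩ := (hp.adj_iff _ _).1 h1
      obtain ⟨k, hk⟩ := (hp.adj_iff _ _).1 h2.symm
      refine ⟨some (j, k), ?_, by simp⟩
      rintro q hq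
      obtain rfl : (j, k) = q := by simpa using hq
      exact ⟨hk, h3, h4⟩
    · refine ⟨none, by simp, fun _ x h1 h2 h3 h4 => h ⟨x, h1, h2, h3, h4⟩⟩
  choose sc hsc1 hsc2 using hsc
  let E := explicitDarts G nbr σ
  have sound : ∀ v i w, Decodes E (fun p => nbr p.1.1 p.1.2) rev sc v i w → nbr v i = w := by
    intro v i w h
    induction h with
    | fwd p => rfl
    | bwd p => exact hrev p.1
    | step v i j k x w h hx hw ihx ihw =>
      have := (hsc1 (v, i) (j, k) h).1
      simp only [ihx, ihw] at this
      exact this.symm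
  have memE : ∀ v i, σ v < σ (nbr v i) → sc (v, i) = none → (v, i) ∈ E := by
    intro v i hlt hn
    simp only [E, explicitDarts, Finset.mem_filter, Finset.mem_univ, true_and, Finset.mem_insert]
    rintro w (rfl | rfl | ⟨h1, h2⟩)
    · exact le_rfl
    · exact hlt.le
    · by_contra! hc
      exact hsc2 (v, i) hn w h1 h2 hc (hc.trans hlt)
  have complete : ∀ m : V, ∀ v i, min (σ v) (σ (nbr v i)) = m →
      Decodes E (fun p => nbr p.1.1 p.1.2) rev sc v i (nbr v i) := by
    intro m
    induction m using (wellFounded_lt (α := V)).induction with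
    | _ m ih =>
    intro v i hm
    cases hs : sc (v, i) with
    | some q =>
      obtain ⟨j, k⟩ := q
      obtain ⟨h1, h2, h3⟩ := hsc1 (v, i) (j, k) hs
      simp only at h1 h2 h3
      have hlt : σ (nbr v j) < m := hm ▸ lt_min h2 h3
      refine Decodes.step v i j k (nbr v j) _ hs ?_ ?_
      · exact ih _ (lt_of_le_of_lt (min_le_right _ _) hlt) v j rfl
      · have := ih _ (lt_of_le_of_lt (min_le_left _ _) hlt) (nbr v j) k rfl
        rwa [h1] at this
    | none =>
      have hne : σ v ≠ σ (nbr v i) := fun h => (hp.adj v i).ne (σ.injective h)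
      rcases hne.lt_or_gt with hlt | hlt
      · exact Decodes.fwd (⟨(v, i), memE v i hlt hs⟩ : E)
      · obtain ⟨k, hk⟩ := (hp.adj_iff _ _).1 (hp.adj v i).symm
        have hn : sc (nbr v i, k) = none := by
          by_contra hne
          obtain ⟨q, hq⟩ := Option.ne_none_iff_exists'.1 hne
          obtain ⟨h1, h2, h3⟩ := hsc1 (nbr v i, k) q hq
          simp only [hk] at h1 h2 h3
          have hv : G.Adj (nbr (nbr v i) q.1) v := (hp.adj_iff _ _).2 ⟨q.2, h1⟩
          exact hsc2 (v, i) hs _ hv.symm (hp.adj _ _) h3 h2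
        have hE : (nbr v i, k) ∈ E := memE _ _ (by rw [hk]; exact hlt) hn
        have hb := Decodes.bwd (E := E) (g := fun p => nbr p.1.1 p.1.2) (rev := rev) (sc := sc)
          (⟨(nbr v i, k), hE⟩ : E)
        have hr := hrev (nbr v i, k)
        simp only [hk] at hb hr
        rwa [hp.inj v hr] at hb
  refine ⟨(⟨⟨E, hM⟩, fun p => nbr p.1.1 p.1.2⟩, rev, sc), ?_⟩
  ext v w
  simp only [GraphCode.graph, SimpleGraph.fromRel_adj]
  constructor
  · rintro ⟨-, ⟨i, h⟩ | ⟨i, h⟩⟩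
    · exact (hp.adj_iff _ _).2 ⟨i, sound _ _ _ h⟩
    · exact ((hp.adj_iff _ _).2 ⟨i, sound _ _ _ h⟩).symm
  · intro h
    refine ⟨h.ne, Or.inl ?_⟩
    obtain ⟨i, rfl⟩ := (hp.adj_iff _ _).1 h
    exact ⟨i, complete _ v i rfl⟩

lemma card_graphCode_le (n d M : ℕ) (hn : 0 < n) :
    Fintype.card (GraphCode (Fin n) d M) ≤
      n ^ M * (2 * d * (d * d + 1)) ^ (n * d) := by
  have h1 : Fintype.card (Σ E : {E : Finset (Fin n × Fin d) // E.card ≤ M}, (E.1 → Fin n)) ≤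
      2 ^ (n * d) * n ^ M := by
    rw [Fintype.card_sigma]
    calc ∑ E : {E : Finset (Fin n × Fin d) // E.card ≤ M}, Fintype.card (E.1 → Fin n)
        ≤ ∑ E : {E : Finset (Fin n × Fin d) // E.card ≤ M}, n ^ M := by
          refine Finset.sum_le_sum fun E _ => ?_
          simp only [Fintype.card_fun, Fintype.card_fin, Fintype.card_coe]
          exact Nat.pow_le_pow_right hn E.2
      _ = Fintype.card {E : Finset (Fin n × Fin d) // E.card ≤ M} * n ^ M := by
          simp
      _ ≤ _ := by
          refine Nat.mul_le_mul_right _ ((Fintype.card_subtype_le _).trans ?_)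
          simp
  simp only [Fintype.card_prod, Fintype.card_fun, Fintype.card_option, Fintype.card_fin]
  calc _ ≤ 2 ^ (n * d) * n ^ M * (d ^ (n * d) * (d * d + 1) ^ (n * d)) :=
        Nat.mul_le_mul_right _ h1
    _ = _ := by rw [mul_pow, mul_pow]; ring

/-- Every triangle gives six ordered triples. -/
lemma six_mul_cliqueCount_three_le {V : Type*} [Fintype V] [DecidableEq V] (G : SimpleGraph V)
    [DecidableRel G.Adj] :
    6 * cliqueCount G 3 ≤ (Finset.univ.filter fun p : V × V × V =>
      G.Adj p.1 p.2.1 ∧ G.Adj p.1 p.2.2 ∧ G.Adj p.2.1 p.2.2).card := by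
  have hc : cliqueCount G 3 = (G.cliqueFinset 3).card := by
    rw [cliqueCount, Nat.card_eq_fintype_card, Fintype.card_subtype]
    rfl
  rw [Finset.card_eq_sum_card_fiberwise (f := fun p : V × V × V => ({p.1, p.2.1, p.2.2} : Finset V))
    (t := G.cliqueFinset 3), hc, mul_comm, ← smul_eq_mul]
  · refine Finset.card_nsmul_le_sum _ _ _ fun t ht => ?_
    obtain ⟨a, b, c, hab, hac, hbc, rfl⟩ :=
      SimpleGraph.is3Clique_iff.1 (SimpleGraph.mem_cliqueFinset_iff.1 ht)
    have h6 : ({(a, b, c), (a, c, b), (b, a, c), (b, c, a), (c, a, b), (c, b, a)} :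
        Finset (V × V × V)).card = 6 := by
      have := hab.ne; have := hac.ne; have := hbc.ne
      have := hab.ne'; have := hac.ne'; have := hbc.ne'
      repeat rw [Finset.card_insert_of_notMem (by simp [*])]
      simp
    rw [← h6]
    refine Finset.card_le_card ?_
    intro p hp
    simp only [Finset.mem_insert, Finset.mem_singleton] at hp
    simp only [Finset.mem_filter, Finset.mem_univ, true_and]
    rcases hp with rfl | rfl | rfl | rfl | rfl | rfl
    · exact ⟨⟨hab, hac, hbc⟩, rfl⟩
    · exact ⟨⟨hac, hab, hbc.symm⟩, by ext; simp; tauto⟩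
    · exact ⟨⟨hab.symm, hbc, hac⟩, by ext; simp; tauto⟩
    · exact ⟨⟨hbc, hab.symm, hac.symm⟩, by ext; simp; tauto⟩
    · exact ⟨⟨hac.symm, hbc.symm, hab⟩, by ext; simp; tauto⟩
    · exact ⟨⟨hbc.symm, hac.symm, hab.symm⟩, by ext; simp; tauto⟩
  · intro p hp
    simp only [Finset.coe_filter, Finset.mem_univ, true_and, Set.mem_ofPred_eq] at hp
    simp only [Finset.mem_coe, SimpleGraph.mem_cliqueFinset_iff]
    exact SimpleGraph.is3Clique_iff.2 ⟨_, _, _, hp.1, hp.2.1, hp.2.2, rfl⟩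

/-- The common neighbours of two vertices. -/
noncomputable def commonNbrs {V : Type*} [Fintype V] (G : SimpleGraph V) (v w : V) : Finset V :=
  open Classical in Finset.univ.filter fun x => G.Adj v x ∧ G.Adj w x

lemma mem_commonNbrs {V : Type*} [Fintype V] {G : SimpleGraph V} {v w x : V} :
    x ∈ commonNbrs G v w ↔ G.Adj v x ∧ G.Adj w x := by
  simp [commonNbrs]

lemma six_mul_cliqueCount_three_le_sum {V : Type*} [Fintype V] {d : ℕ} {G : SimpleGraph V}
    {nbr : V → Fin d → V} (hp : IsPorts G nbr) :
    6 * cliqueCount G 3 ≤ ∑ p : V × Fin d, (commonNbrs G p.1 (nbr p.1 p.2)).card := by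
  classical
  refine (six_mul_cliqueCount_three_le G).trans ?_
  rw [← Finset.card_sigma]
  refine Finset.card_le_card_of_surjOn
    (fun q : (Σ _ : V × Fin d, V) => (q.1.1, nbr q.1.1 q.1.2, q.2)) ?_
  rintro ⟨a, b, c⟩ h
  simp only [Finset.coe_filter, Finset.mem_univ, true_and, Set.mem_ofPred_eq] at h
  obtain ⟨i, rfl⟩ := (hp.adj_iff _ _).1 h.1
  refine ⟨⟨(a, i), c⟩, ?_, rfl⟩
  simp [mem_commonNbrs, h.2.1, h.2.2]

lemma IsPorts.image_univ {V : Type*} [Fintype V] [DecidableEq V] {d : ℕ} {G : SimpleGraph V}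
    {nbr : V → Fin d → V} [DecidableRel G.Adj] (hp : IsPorts G nbr) (v : V) :
    Finset.univ.image (nbr v) = Finset.univ.filter (G.Adj v) := by
  ext w
  simp [hp.adj_iff]

lemma IsPorts.card_filter_adj {V : Type*} [Fintype V] {d : ℕ} {G : SimpleGraph V}
    {nbr : V → Fin d → V} [DecidableRel G.Adj] (hp : IsPorts G nbr) (v : V) :
    (Finset.univ.filter (G.Adj v)).card = d := by
  classical
  rw [← hp.image_univ, Finset.card_image_of_injective _ (hp.inj v)]
  simp

lemma card_commonNbrs_lt {V : Type*} [Fintype V] {d : ℕ} {G : SimpleGraph V}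
    {nbr : V → Fin d → V} (hp : IsPorts G nbr) {v w : V} (h : G.Adj v w) :
    (commonNbrs G v w).card < d := by
  classical
  rw [← hp.card_filter_adj v]
  refine Finset.card_lt_card ⟨fun x hx => ?_, fun hs => ?_⟩
  · simpa using (mem_commonNbrs.1 hx).1
  · have := hs (by simpa using h : w ∈ Finset.univ.filter (G.Adj v))
    exact G.loopless.irrefl _ (mem_commonNbrs.1 this).2

/-- If two adjacent vertices have `d - 1` common neighbours, every other neighbour of the first
one is a neighbour of the second one. -/
lemma adj_of_card_commonNbrs {V : Type*} [Fintype V] {d : ℕ} {G : SimpleGraph V}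
    {nbr : V → Fin d → V} (hp : IsPorts G nbr) {v w x : V} (h : G.Adj v w)
    (hc : d ≤ (commonNbrs G v w).card + 1) (hx : G.Adj v x) (hne : w ≠ x) : G.Adj w x := by
  classical
  by_contra hwx
  have hsub : insert w (insert x (commonNbrs G v w)) ⊆ Finset.univ.filter (G.Adj v) := by
    intro y hy
    simp only [Finset.mem_insert, mem_commonNbrs] at hy
    rcases hy with rfl | rfl | hy
    · simpa using h
    · simpa using hx
    · simpa using hy.1
  have := Finset.card_le_card hsub
  rw [hp.card_filter_adj, Finset.card_insert_of_notMem, Finset.card_insert_of_notMem] at this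
  · omega
  · simp [mem_commonNbrs, hwx]
  · simp [mem_commonNbrs, hne]

/-- A bad vertex has an edge that lies in some triangles, but in fewer than `d - 1`. -/
lemma BadVertex.exists_port {V : Type*} [Fintype V] {d : ℕ} {G : SimpleGraph V}
    {nbr : V → Fin d → V} (hp : IsPorts G nbr) {v : V} (hv : BadVertex G d v) :
    ∃ i, 1 ≤ (commonNbrs G v (nbr v i)).card ∧ (commonNbrs G v (nbr v i)).card + 2 ≤ d := by
  classical
  obtain ⟨⟨t, ht, hvt⟩, hno⟩ := hv
  by_contra! hcon
  have full : ∀ w x, G.Adj v w → G.Adj v x → G.Adj w x → ∀ y, G.Adj v y → w ≠ y →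
      G.Adj w y := by
    intro w x hw hx hwx y hy hwy
    obtain ⟨i, rfl⟩ := (hp.adj_iff _ _).1 hw
    refine adj_of_card_commonNbrs hp hw ?_ hy hwy
    have := hcon i (Finset.card_pos.2 ⟨x, mem_commonNbrs.2 ⟨hx, hwx⟩⟩)
    omega
  obtain ⟨a, ha, b, hb, hab⟩ : ∃ a, G.Adj v a ∧ ∃ b, G.Adj v b ∧ G.Adj a b := by
    obtain ⟨a, b, c, hab, hac, hbc, rfl⟩ := SimpleGraph.is3Clique_iff.1 ht
    simp only [Finset.mem_insert, Finset.mem_singleton] at hvt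
    rcases hvt with rfl | rfl | rfl
    · exact ⟨b, hab, c, hac, hbc⟩
    · exact ⟨a, hab.symm, c, hbc, hac⟩
    · exact ⟨a, hac.symm, b, hbc.symm, hab⟩
  have hall : ∀ w x, G.Adj v w → G.Adj v x → w ≠ x → G.Adj w x := by
    intro w x hw hx hwx
    by_cases hwa : w = a
    · subst hwa
      exact full w b hw hb hab x hx hwx
    · exact full w a hw ha (full a b ha hb hab w hw (Ne.symm hwa)).symm x hx hwx
  refine hno ⟨insert v (Finset.univ.filter (G.Adj v)), ?_, by simp⟩
  rw [SimpleGraph.isNClique_iff, Finset.card_insert_of_notMem (by simp), hp.card_filter_adj]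
  refine ⟨?_, rfl⟩
  intro x hx y hy hxy
  simp only [Finset.coe_insert, Finset.coe_filter, Finset.mem_univ, true_and,
    Set.mem_insert_iff, Set.mem_ofPred_eq] at hx hy
  rcases hx with rfl | hx <;> rcases hy with rfl | hy
  · exact absurd rfl hxy
  · exact hy
  · exact hx.symm
  · exact hall x y hx hy hxy

lemma badVertexCount_le {V : Type*} [Fintype V] {d : ℕ} {G : SimpleGraph V}
    {nbr : V → Fin d → V} (hp : IsPorts G nbr) :
    badVertexCount G d ≤ (Finset.univ.filter fun p : V × Fin d =>
      1 ≤ (commonNbrs G p.1 (nbr p.1 p.2)).card ∧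
        (commonNbrs G p.1 (nbr p.1 p.2)).card + 2 ≤ d).card := by
  classical
  rw [badVertexCount, Nat.card_eq_fintype_card, Fintype.card_subtype]
  refine Finset.card_le_card_of_surjOn Prod.fst ?_
  intro v hv
  obtain ⟨i, hi⟩ := BadVertex.exists_port hp (by simpa using hv)
  exact ⟨(v, i), by simpa using hi, rfl⟩

lemma inv_add_two_le {d k : ℕ} (hk : k < d) :
    1 / ((k : ℝ) + 2) ≤ 1 / 2 - k / (2 * (d + 1)) -
      (if 1 ≤ k ∧ k + 2 ≤ d then 1 / (6 * ((d : ℝ) + 1)) else 0) := by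
  have hk' : (k : ℝ) + 1 ≤ d := by exact_mod_cast hk
  have hk0 : (0 : ℝ) ≤ k := k.cast_nonneg
  have hd0 : (0 : ℝ) < d + 1 := by positivity
  rw [← sub_nonneg]
  split_ifs with h
  · have h1 : (1 : ℝ) ≤ k := by exact_mod_cast h.1
    have h2 : (k : ℝ) + 2 ≤ d := by exact_mod_cast h.2
    have : 1 / 2 - (k : ℝ) / (2 * (d + 1)) - 1 / (6 * ((d : ℝ) + 1)) - 1 / ((k : ℝ) + 2) =
        (3 * k * (d - 1 - k) - (k + 2)) / (6 * (d + 1) * (k + 2)) := by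
      field_simp
      ring
    rw [this]
    refine div_nonneg ?_ (by positivity)
    nlinarith
  · have : 1 / 2 - (k : ℝ) / (2 * (d + 1)) - 0 - 1 / ((k : ℝ) + 2) =
        (k * (d - 1 - k)) / (2 * (d + 1) * (k + 2)) := by
      field_simp
      ring
    rw [this]
    refine div_nonneg (mul_nonneg hk0 (by linarith)) (by positivity)

/-- Some vertex order leaves few explicit darts. -/
lemma exists_card_explicitDarts_le {V : Type*} [Fintype V] [LinearOrder V] {d : ℕ}
    {G : SimpleGraph V} {nbr : V → Fin d → V} (hp : IsPorts G nbr) :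
    ∃ σ : Equiv.Perm V, ((explicitDarts G nbr σ).card : ℝ) ≤
      Fintype.card V * d / 2 - 3 * cliqueCount G 3 / (d + 1) -
        badVertexCount G d / (6 * (d + 1)) := by
  classical
  set B : ℝ := Fintype.card V * d / 2 - 3 * cliqueCount G 3 / (d + 1) -
        badVertexCount G d / (6 * (d + 1)) with hB
  set k : V × Fin d → ℕ := fun p => (commonNbrs G p.1 (nbr p.1 p.2)).card
  have hsum : ∑ p, 1 / ((k p : ℝ) + 2) ≤ B := by
    have hd0 : (0 : ℝ) < d + 1 := by positivity
    calc ∑ p, 1 / ((k p : ℝ) + 2)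
        ≤ ∑ p, (1 / 2 - k p / (2 * ((d : ℝ) + 1)) -
            (if 1 ≤ k p ∧ k p + 2 ≤ d then 1 / (6 * ((d : ℝ) + 1)) else 0)) :=
          Finset.sum_le_sum fun p _ => inv_add_two_le (card_commonNbrs_lt hp (hp.adj _ _))
      _ = Fintype.card V * d / 2 - ((∑ p, k p : ℕ) : ℝ) / (2 * (d + 1)) -
            ((Finset.univ.filter fun p => 1 ≤ k p ∧ k p + 2 ≤ d).card : ℝ) /
              (6 * (d + 1)) := by
          rw [Finset.sum_sub_distrib, Finset.sum_sub_distrib, 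
            ← Finset.sum_div _ (fun p => (k p : ℝ)), ← Finset.sum_filter]
          simp only [Finset.sum_const, Finset.card_univ, Fintype.card_prod, Fintype.card_fin]
          push_cast
          simp only [nsmul_eq_mul]
          push_cast
          ring
      _ ≤ B := by
          have h1 : (6 * cliqueCount G 3 : ℝ) ≤ ((∑ p, k p : ℕ) : ℝ) := by
            exact_mod_cast six_mul_cliqueCount_three_le_sum hp
          have h2 : (badVertexCount G d : ℝ) ≤
              ((Finset.univ.filter fun p => 1 ≤ k p ∧ k p + 2 ≤ d).card : ℝ) := by
            exact_mod_cast badVertexCount_le hp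
          have h3 : 3 * (cliqueCount G 3 : ℝ) / (d + 1) = 6 * cliqueCount G 3 / (2 * (d + 1)) := by
            field_simp
            ring
          rw [hB, h3]
          gcongr
  have hfac : ∀ p, ((Finset.univ.filter fun σ : Equiv.Perm V =>
      p ∈ explicitDarts G nbr σ).card : ℝ) =
        (Fintype.card V).factorial * (1 / ((k p : ℝ) + 2)) := by
    intro p
    have hS : (insert p.1 (insert (nbr p.1 p.2) (commonNbrs G p.1 (nbr p.1 p.2)))).card =
        k p + 2 := by
      rw [Finset.card_insert_of_notMem, Finset.card_insert_of_notMem]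
      · simp [mem_commonNbrs]
      · simp [mem_commonNbrs, (hp.adj p.1 p.2).ne]
    have := card_mul_card_perm_min
      (insert p.1 (insert (nbr p.1 p.2) (commonNbrs G p.1 (nbr p.1 p.2))))
      (Finset.mem_insert_self _ _)
    rw [hS] at this
    rw [mul_one_div, eq_div_iff (by positivity), mul_comm]
    rw [← this]
    push_cast
    congr 3
    ext σ
    simp [explicitDarts, commonNbrs]
  by_contra! hcon
  have hlt : ∑ σ : Equiv.Perm V, B < ∑ σ : Equiv.Perm V, ((explicitDarts G nbr σ).card : ℝ) :=
    Finset.sum_lt_sum_of_nonempty Finset.univ_nonempty fun σ _ => hcon σ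
  have heq : ∑ σ : Equiv.Perm V, ((explicitDarts G nbr σ).card : ℝ) =
      ∑ p, ((Finset.univ.filter fun σ : Equiv.Perm V => p ∈ explicitDarts G nbr σ).card : ℝ) := by
    have : ∀ σ, (explicitDarts G nbr σ).card = ∑ p, if p ∈ explicitDarts G nbr σ then 1 else 0 := by
      intro σ
      simp
    simp only [this, Finset.card_filter, Nat.cast_sum]
    exact Finset.sum_comm
  rw [heq, Finset.sum_congr rfl fun p _ => hfac p, ← Finset.mul_sum] at hlt
  simp only [Finset.sum_const, Finset.card_univ, Fintype.card_perm, nsmul_eq_mul] at hlt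
  exact absurd hsum (not_le.2 (lt_of_mul_lt_mul_left hlt (by positivity)))

/-- The number of `d`-regular graphs with many triangles and at least `t` bad vertices. -/
lemma card_Gdc_bad_le {n d : ℕ} (hn : 0 < n) (c t : ℝ) :
    (Nat.card {G : SimpleGraph (Fin n) | G ∈ Gdc n d c ∧ t ≤ (badVertexCount G d : ℝ)} : ℝ) ≤
      (n : ℝ) ^ ((n : ℝ) * d / 2 - c * n * d.choose 2 / (d + 1) - t / (6 * (d + 1))) *
        ((2 * d * (d * d + 1) : ℕ) : ℝ) ^ (n * d) := by
  set X : ℝ := (n : ℝ) * d / 2 - c * n * d.choose 2 / (d + 1) - t / (6 * (d + 1)) with hX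
  have hn1 : (1 : ℝ) ≤ n := by exact_mod_cast hn
  have key : ∀ G ∈ {G : SimpleGraph (Fin n) | G ∈ Gdc n d c ∧ t ≤ (badVertexCount G d : ℝ)},
      ∃ m : ℕ, (m : ℝ) ≤ X ∧ ∀ M, m ≤ M → ∃ C : GraphCode (Fin n) d M, C.graph = G := by
    rintro G ⟨⟨hreg, htri⟩, hbad⟩
    obtain ⟨nbr, hp⟩ := hreg.exists_isPorts
    obtain ⟨σ, hσ⟩ := exists_card_explicitDarts_le hp
    refine ⟨_, hσ.trans ?_, fun M hM => exists_graphCode hp σ hM⟩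
    have h1 : c * n * d.choose 2 / (d + 1) ≤ 3 * (cliqueCount G 3 : ℝ) / (d + 1) := by
      refine div_le_div_of_nonneg_right ?_ (by positivity)
      linarith
    have h2 : t / (6 * (d + 1)) ≤ (badVertexCount G d : ℝ) / (6 * (d + 1)) := by
      gcongr
    rw [Fintype.card_fin]
    linarith
  set B := {G : SimpleGraph (Fin n) | G ∈ Gdc n d c ∧ t ≤ (badVertexCount G d : ℝ)}
  rcases B.eq_empty_or_nonempty with hB | ⟨G₀, hG₀⟩
  · rw [hB]
    simp only [Nat.card_eq_fintype_card, Fintype.card_eq_zero, Nat.cast_zero]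
    positivity
  · obtain ⟨m₀, hm₀, -⟩ := key G₀ hG₀
    have hX0 : 0 ≤ X := le_trans m₀.cast_nonneg hm₀
    have hsub : B ⊆ Set.range (GraphCode.graph : GraphCode (Fin n) d ⌊X⌋₊ → _) := by
      intro G hG
      obtain ⟨m, hm, h⟩ := key G hG
      exact h _ (Nat.le_floor hm)
    have hcard : Nat.card B ≤ n ^ ⌊X⌋₊ * (2 * d * (d * d + 1)) ^ (n * d) := by
      refine le_trans ?_ (card_graphCode_le n d ⌊X⌋₊ hn)
      rw [← Nat.card_eq_fintype_card]
      exact (Nat.card_mono (Set.toFinite _) hsub).trans (Finite.card_range_le _)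
    calc (Nat.card B : ℝ) ≤ ((n ^ ⌊X⌋₊ * (2 * d * (d * d + 1)) ^ (n * d) : ℕ) : ℝ) := by
          exact_mod_cast hcard
      _ = (n : ℝ) ^ (⌊X⌋₊ : ℝ) * ((2 * d * (d * d + 1) : ℕ) : ℝ) ^ (n * d) := by
          rw [Real.rpow_natCast]
          push_cast
          ring
      _ ≤ _ := by
          gcongr
          exact Nat.floor_le hX0

/-- The vertices of `a` cliques on `d + 1` vertices and a bipartite graph with parts of size
`d * q`. -/
abbrev TemplateVertex (d a q : ℕ) : Type :=
  (Fin (d + 1) × Fin a) ⊕ ((Fin d × Fin q) ⊕ (Fin d × Fin q))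

/-- The permutations that define a template graph. -/
abbrev TemplateData (d a q : ℕ) : Type :=
  (Fin d → Equiv.Perm (Fin a)) × (Fin d → Fin d → Equiv.Perm (Fin q))

/-- The permutation that assigns to each clique its vertex in the class `i`. -/
def TemplateData.perm {d a q : ℕ} (p : TemplateData d a q) : Fin (d + 1) → Equiv.Perm (Fin a) :=
  Fin.cons 1 p.1

/-- The adjacency relation of the template graph. -/
def TemplateData.Adj {d a q : ℕ} (p : TemplateData d a q) :
    TemplateVertex d a q → TemplateVertex d a q → Prop
  | .inl (i, x), .inl (j, y) => i ≠ j ∧ (p.perm i).symm x = (p.perm j).symm y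
  | .inr (.inl (i, x)), .inr (.inr (j, y)) => p.2 i j x = y
  | .inr (.inr (j, y)), .inr (.inl (i, x)) => p.2 i j x = y
  | _, _ => False

/-- The disjoint union of `a` cliques on `d + 1` vertices and a `d`-regular bipartite graph made of
`d * d` matchings between the `d` classes of each part. -/
def TemplateData.graph {d a q : ℕ} (p : TemplateData d a q) :
    SimpleGraph (TemplateVertex d a q) where
  Adj := p.Adj
  symm := ⟨by
    rintro (⟨i, x⟩ | ⟨i, x⟩ | ⟨i, x⟩) (⟨j, y⟩ | ⟨j, y⟩ | ⟨j, y⟩) h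
    case inl.inl => exact ⟨h.1.symm, h.2.symm⟩
    all_goals exact h⟩
  loopless := ⟨by
    rintro (⟨i, x⟩ | ⟨i, x⟩ | ⟨i, x⟩) h
    · exact h.1 rfl
    · exact h
    · exact h⟩

/-- The port numbering of the template graph. -/
def TemplateData.nbr {d a q : ℕ} (p : TemplateData d a q) :
    TemplateVertex d a q → Fin d → TemplateVertex d a q
  | .inl (i, x), k => .inl (i.succAbove k, p.perm (i.succAbove k) ((p.perm i).symm x))
  | .inr (.inl (i, x)), j => .inr (.inr (j, p.2 i j x))
  | .inr (.inr (j, y)), i => .inr (.inl (i, (p.2 i j).symm y))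

lemma TemplateData.isPorts {d a q : ℕ} (p : TemplateData d a q) : IsPorts p.graph p.nbr where
  inj := by
    rintro (⟨i, x⟩ | ⟨i, x⟩ | ⟨i, x⟩) k l h <;>
      simp only [TemplateData.nbr, Sum.inl.injEq, Sum.inr.injEq, Prod.mk.injEq] at h
    · exact Fin.succAbove_right_injective h.1
    · exact h.1
    · exact h.1
  adj_iff := by
    rintro (⟨i, x⟩ | ⟨i, x⟩ | ⟨i, x⟩) (⟨j, y⟩ | ⟨j, y⟩ | ⟨j, y⟩) <;>
      simp only [TemplateData.nbr, TemplateData.graph, TemplateData.Adj, Sum.inl.injEq,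
        Sum.inr.injEq, Prod.mk.injEq, reduceCtorEq, exists_false]
    · constructor
      · rintro ⟨hij, h⟩
        obtain ⟨k, rfl⟩ := Fin.exists_succAbove_eq hij.symm
        exact ⟨k, rfl, by rw [h]; simp⟩
      · rintro ⟨k, rfl, rfl⟩
        exact ⟨(Fin.succAbove_ne i k).symm, by simp⟩
    · constructor
      · rintro h
        exact ⟨j, rfl, h⟩
      · rintro ⟨k, rfl, h⟩
        exact h
    · constructor
      · rintro rfl
        exact ⟨j, rfl, by simp⟩
      · rintro ⟨k, rfl, rfl⟩
        simp

lemma TemplateData.graph_injective {d a q : ℕ} :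
    Function.Injective (TemplateData.graph : TemplateData d a q → _) := by
  intro p p' h
  have hadj : ∀ v w, p.Adj v w ↔ p'.Adj v w := fun v w => by
    change p.graph.Adj v w ↔ p'.graph.Adj v w
    rw [h]
  refine Prod.ext ?_ ?_
  · funext i
    ext1 x
    have := (hadj (.inl (0, x)) (.inl (i.succ, p.1 i x))).1
      ⟨(Fin.succ_ne_zero i).symm, by
        simp only [TemplateData.perm, Fin.cons_zero, Fin.cons_succ, Equiv.symm_apply_apply]
        rfl⟩
    have h2 := this.2
    simp only [TemplateData.perm, Fin.cons_zero, Fin.cons_succ] at h2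
    exact ((Equiv.eq_symm_apply _).1 h2).symm
  · funext i j
    ext1 x
    exact ((hadj (.inr (.inl (i, x))) (.inr (.inr (j, p.2 i j x)))).1 rfl).symm

lemma IsPorts.comap_symm {V W : Type*} {d : ℕ} {G : SimpleGraph V} {nbr : V → Fin d → V}
    (hp : IsPorts G nbr) (e : V ≃ W) :
    IsPorts (G.comap e.symm) (fun v i => e (nbr (e.symm v) i)) where
  inj := fun v => e.injective.comp (hp.inj _)
  adj_iff := fun v w => by
    simp only [SimpleGraph.comap_adj, hp.adj_iff, Equiv.eq_symm_apply]

/-- Disjoint cliques on `m` vertices contribute all their triples to the number of triangles. -/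
lemma mul_choose_three_le_cliqueCount {V : Type*} [Finite V] {a m : ℕ} (G : SimpleGraph V)
    (φ : Fin a × Fin m → V) (hφ : Function.Injective φ)
    (hadj : ∀ x i j, i ≠ j → G.Adj (φ (x, i)) (φ (x, j))) :
    a * m.choose 3 ≤ cliqueCount G 3 := by
  classical
  have hinj : ∀ x, Function.Injective fun i => φ (x, i) := fun x i j h => by
    simpa using hφ h
  let f : Fin a × {s : Finset (Fin m) // s ∈ Finset.powersetCard 3 Finset.univ} →
      {t : Finset V // G.IsNClique 3 t} := fun y =>
    ⟨y.2.1.map ⟨fun i => φ (y.1, i), hinj y.1⟩, by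
      rw [SimpleGraph.isNClique_iff, Finset.card_map]
      refine ⟨?_, (Finset.mem_powersetCard.1 y.2.2).2⟩
      rintro _ hv _ hw hne
      simp only [Finset.coe_map, Set.mem_image, Finset.mem_coe,
        Function.Embedding.coeFn_mk] at hv hw
      obtain ⟨i, -, rfl⟩ := hv
      obtain ⟨j, -, rfl⟩ := hw
      exact hadj _ _ _ fun h => hne (by rw [h])⟩
  have hf : Function.Injective f := by
    rintro ⟨x, s, hs⟩ ⟨x', s', hs'⟩ h
    have h' := congrArg Subtype.val h
    simp only [f] at h'
    have hpos : 0 < s.card := by rw [(Finset.mem_powersetCard.1 hs).2]; norm_num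
    obtain ⟨i, hi⟩ := Finset.card_pos.1 hpos
    have hm : φ (x, i) ∈ s.map ⟨fun i => φ (x, i), hinj x⟩ :=
      Finset.mem_map.2 ⟨i, hi, rfl⟩
    rw [h'] at hm
    simp only [Finset.mem_map, Function.Embedding.coeFn_mk] at hm
    obtain ⟨j, -, hj⟩ := hm
    obtain rfl : x' = x := congrArg Prod.fst (hφ hj)
    obtain rfl : s = s' := Finset.map_injective _ h'
    rfl
  have := Nat.card_le_card_of_injective f hf
  rw [cliqueCount]
  refine le_trans (le_of_eq ?_) this
  simp [Nat.card_eq_fintype_card]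

lemma card_templateData_le {n d a q : ℕ} {c : ℝ} (hn : a * (d + 1) + 2 * d * q = n)
    (hc : c * n ≤ a * (d + 1)) :
    (a.factorial) ^ d * (q.factorial) ^ (d * d) ≤ Nat.card (Gdc n d c) := by
  have hcard : Fintype.card (TemplateVertex d a q) = n := by
    simp only [Fintype.card_sum, Fintype.card_prod, Fintype.card_fin]
    rw [← hn]
    ring
  let e : TemplateVertex d a q ≃ Fin n := Fintype.equivFinOfCardEq hcard
  have hmem : ∀ p : TemplateData d a q, p.graph.comap e.symm ∈ Gdc n d c := by
    intro p
    refine ⟨(p.isPorts.comap_symm e).isDRegular, ?_⟩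
    have h := mul_choose_three_le_cliqueCount (a := a) (m := d + 1) (p.graph.comap e.symm)
      (fun y => e (.inl (y.2, p.perm y.2 y.1))) ?_ ?_
    · have hch : (d + 1) * d.choose 2 = (d + 1).choose 3 * 3 := Nat.add_one_mul_choose_eq d 2
      have hch' : ((d : ℝ) + 1) * d.choose 2 = (d + 1).choose 3 * 3 := by exact_mod_cast hch
      have h' : (a : ℝ) * (d + 1).choose 3 ≤ cliqueCount (p.graph.comap e.symm) 3 := by
        exact_mod_cast h
      have := mul_le_mul_of_nonneg_right hc (Nat.cast_nonneg (α := ℝ) (d.choose 2))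
      have h3 : (a : ℝ) * (d + 1) * d.choose 2 = 3 * (a * (d + 1).choose 3) := by
        rw [mul_assoc, hch']
        ring
      linarith
    · rintro ⟨x, i⟩ ⟨y, j⟩ h
      have h1 := e.injective h
      simp only [Sum.inl.injEq, Prod.mk.injEq] at h1
      obtain ⟨rfl, h2⟩ := h1
      rw [(p.perm i).injective h2]
    · intro x i j hij
      simp only [SimpleGraph.comap_adj, Equiv.symm_apply_apply]
      exact ⟨hij, by simp⟩
  have hinj : Function.Injective fun p : TemplateData d a q =>
      (⟨p.graph.comap e.symm, hmem p⟩ : Gdc n d c) := by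
    intro p p' h
    refine TemplateData.graph_injective ?_
    have h' := congrArg Subtype.val h
    ext v w
    have := congrArg (fun G : SimpleGraph (Fin n) => G.Adj (e v) (e w)) h'
    simpa using this
  refine le_trans (le_of_eq ?_) (Nat.card_le_card_of_injective _ hinj)
  simp [Nat.card_eq_fintype_card, Fintype.card_perm, pow_mul]

lemma exists_template_sizes {n d : ℕ} {c : ℝ} (hd : 0 < d) (hc : 0 ≤ c) (he : Even (n * d))
    (hn : c * n + (2 * d + 1) * (d + 1) ≤ n) :
    ∃ a q : ℕ, a * (d + 1) + 2 * d * q = n ∧ c * n ≤ a * (d + 1) ∧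
      (a : ℝ) ≤ c * n / (d + 1) + (2 * d + 1) := by
  set a₀ := ⌈c * n / (d + 1)⌉₊ with ha₀
  set r := ((d + 1) * n + (2 * d - 1) * a₀) % (2 * d) with hr
  have hd1 : (0 : ℝ) < d + 1 := by positivity
  have h1 : c * n / (d + 1) ≤ a₀ := Nat.le_ceil _
  have h2 : (a₀ : ℝ) < c * n / (d + 1) + 1 := Nat.ceil_lt_add_one (by positivity)
  have h3 : (r : ℝ) ≤ 2 * d := by
    have : r < 2 * d := Nat.mod_lt _ (by omega)
    exact_mod_cast this.le
  have hle : ((a₀ + r : ℕ) : ℝ) ≤ c * n / (d + 1) + (2 * d + 1) := by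
    push_cast
    linarith
  have hmul : (a₀ + r) * (d + 1) ≤ n := by
    have : ((a₀ + r : ℕ) : ℝ) * (d + 1) ≤ n := by
      refine (mul_le_mul_of_nonneg_right hle hd1.le).trans (le_trans (le_of_eq ?_) hn)
      field_simp
    exact_mod_cast this
  have hmod : a₀ + r ≡ (d + 1) * n [MOD 2 * d] := by
    calc a₀ + r ≡ a₀ + ((d + 1) * n + (2 * d - 1) * a₀) [MOD 2 * d] :=
          Nat.ModEq.add_left _ (Nat.mod_modEq _ _)
      _ = (d + 1) * n + (2 * d) * a₀ := by
          obtain ⟨k, hk⟩ : ∃ k, 2 * d = k + 1 := ⟨2 * d - 1, by omega⟩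
          rw [hk, Nat.add_sub_cancel]
          ring
      _ ≡ (d + 1) * n [MOD 2 * d] := by
          simp [Nat.ModEq]
  have hmod2 : (a₀ + r) * (d + 1) ≡ n [MOD 2 * d] := by
    obtain ⟨m, hm⟩ := he
    calc (a₀ + r) * (d + 1) ≡ (d + 1) * n * (d + 1) [MOD 2 * d] := hmod.mul_right _
      _ = n + 2 * d * (m + n) := by
          have : (d + 1) * n * (d + 1) = n + d * (n * d) + 2 * d * n := by ring
          rw [this, hm]
          ring
      _ ≡ n [MOD 2 * d] := by
          simp [Nat.ModEq]
  obtain ⟨q, hq⟩ := (Nat.modEq_iff_dvd' hmul).1 hmod2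
  refine ⟨a₀ + r, q, by omega, ?_, hle⟩
  rw [div_le_iff₀ hd1] at h1
  refine h1.trans ?_
  push_cast
  gcongr
  simp

lemma pow_le_factorial_mul_exp (n k : ℕ) :
    (n : ℝ) ^ k ≤ k.factorial * Real.exp n := by
  have := Real.pow_div_factorial_le_exp (n : ℝ) n.cast_nonneg k
  rwa [div_le_iff₀ (by positivity), mul_comm] at this

/-- There are many `d`-regular graphs with many triangles. -/
lemma rpow_le_card_Gdc {n d : ℕ} {c : ℝ} (hd : 0 < d) (hc : 0 ≤ c) (he : Even (n * d))
    (hn : c * n + (2 * d + 1) * (d + 1) ≤ n) (hn0 : 0 < n) :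
    (n : ℝ) ^ ((n : ℝ) * d / 2 - c * n * d.choose 2 / (d + 1) - (2 * d + 1) * d.choose 2) ≤
      Nat.card (Gdc n d c) * Real.exp ((d + d * d) * n) := by
  obtain ⟨a, q, hsum, h1, h2⟩ := exists_template_sizes hd hc he hn
  have hcard := card_templateData_le hsum h1
  have hn1 : (1 : ℝ) ≤ n := by exact_mod_cast hn0
  have hsum' : (a : ℝ) * (d + 1) + 2 * d * q = n := by exact_mod_cast hsum
  calc (n : ℝ) ^ ((n : ℝ) * d / 2 - c * n * d.choose 2 / (d + 1) - (2 * d + 1) * d.choose 2)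
      ≤ (n : ℝ) ^ ((a * d + q * (d * d) : ℕ) : ℝ) := by
        refine Real.rpow_le_rpow_of_exponent_le hn1 ?_
        have h3 := mul_le_mul_of_nonneg_right h2 (Nat.cast_nonneg (α := ℝ) (d.choose 2))
        have h4 : (c * n / (d + 1) + (2 * d + 1)) * (d.choose 2 : ℝ) =
          c * n * d.choose 2 / (d + 1) + (2 * d + 1) * d.choose 2 := by ring
        have h5 : ((a * d + q * (d * d) : ℕ) : ℝ) = (n : ℝ) * d / 2 - a * d.choose 2 := by
          rw [Nat.cast_choose_two, ← hsum']
          push_cast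
          ring
        rw [h5]
        linarith
    _ = ((n : ℝ) ^ a) ^ d * ((n : ℝ) ^ q) ^ (d * d) := by
        rw [Real.rpow_natCast, pow_add, pow_mul, pow_mul]
    _ ≤ (a.factorial * Real.exp n) ^ d * (q.factorial * Real.exp n) ^ (d * d) := by
        gcongr <;> exact pow_le_factorial_mul_exp _ _
    _ = ((a.factorial ^ d * q.factorial ^ (d * d) : ℕ) : ℝ) * Real.exp ((d + d * d) * n) := by
        have : Real.exp ((d + d * d) * n) = Real.exp n ^ d * Real.exp n ^ (d * d) := by
          rw [← pow_add, ← Real.exp_nat_mul]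
          push_cast
          rfl
        rw [this, mul_pow, mul_pow]
        push_cast
        ring
    _ ≤ _ := by
        gcongr

/-- Structure theorem for fixed `d`: the proportion of graphs in `G_{d,c}(n)` with at least
`(log log n / log n) * n` bad vertices tends to `0` as `n → ∞` along `n` with `n*d` even. -/
theorem structure_fixed_d (d : ℕ) (hd : 3 ≤ d) (c : ℝ) (hc0 : 0 < c) (hc1 : c < 1) :
    Tendsto
      (fun n : ℕ =>
        (Nat.card {G : SimpleGraph (Fin n) | G ∈ Gdc n d c ∧
            Real.log (Real.log n) / Real.log n * n ≤ (badVertexCount G d : ℝ)} : ℝ) /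
          (Nat.card (Gdc n d c) : ℝ))
      (atTop ⊓ 𝓟 {n : ℕ | Even (n * d)}) (nhds 0) := by
  have hd0 : 0 < d := by omega
  set K : ℝ := ((2 * d * (d * d + 1) : ℕ) : ℝ) with hK
  have hK0 : 0 < K := by
    rw [hK]
    positivity
  set A : ℝ := (2 * d + 1) * d.choose 2 with hA
  have hA0 : 0 ≤ A := by positivity
  set C : ℝ := A + d * Real.log K + (d + d * d) with hC
  have hlog : Tendsto (fun n : ℕ => Real.log n) atTop atTop :=
    Real.tendsto_log_atTop.comp tendsto_natCast_atTop_atTop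
  have hloglog : Tendsto (fun n : ℕ => Real.log (Real.log n)) atTop atTop :=
    Real.tendsto_log_atTop.comp hlog
  have hlim : Tendsto (fun n : ℕ =>
      Real.exp ((n : ℝ) * (C - Real.log (Real.log n) / (6 * (d + 1))))) atTop (nhds 0) := by
    refine Real.tendsto_exp_atBot.comp (tendsto_natCast_atTop_atTop.atTop_mul_atBot₀ ?_)
    simp only [sub_eq_add_neg]
    exact tendsto_atBot_add_const_left _ _
      (tendsto_neg_atTop_atBot.comp (hloglog.atTop_div_const (by positivity)))
  have hlarge : ∀ᶠ n : ℕ in atTop, c * n + (2 * d + 1) * (d + 1) ≤ n := by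
    have h : Tendsto (fun n : ℕ => (n : ℝ) * (1 - c)) atTop atTop :=
      tendsto_natCast_atTop_atTop.atTop_mul_const (by linarith)
    filter_upwards [h.eventually_ge_atTop ((2 * d + 1) * (d + 1))] with n hn
    linarith
  refine tendsto_of_tendsto_of_tendsto_of_le_of_le' tendsto_const_nhds
    (hlim.mono_left inf_le_left) (Eventually.of_forall fun n => by positivity) ?_
  rw [eventually_inf_principal]
  filter_upwards [hlarge, eventually_gt_atTop 0, hlog.eventually_gt_atTop 0] with n hn hn0 hL he
  have hn0' : (0 : ℝ) < n := by exact_mod_cast hn0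
  have hlow := rpow_le_card_Gdc hd0 hc0.le he hn hn0
  have hup := card_Gdc_bad_le (d := d) hn0 c (Real.log (Real.log n) / Real.log n * n)
  set Y : ℝ := (n : ℝ) * d / 2 - c * n * d.choose 2 / (d + 1) with hY
  have hpos : (0 : ℝ) < Nat.card (Gdc n d c) :=
    pos_of_mul_pos_left (lt_of_lt_of_le (Real.rpow_pos_of_pos hn0' _) hlow) (Real.exp_pos _).le
  rw [div_le_iff₀ hpos]
  have hKexp : K ^ (n * d) = Real.exp (n * d * Real.log K) := by
    rw [← Real.rpow_natCast, Real.rpow_def_of_pos hK0]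
    push_cast
    ring_nf
  rw [← hA, Real.rpow_def_of_pos hn0'] at hlow
  rw [← hK, Real.rpow_def_of_pos hn0', hKexp, ← Real.exp_add] at hup
  have hlow' : Real.exp (Real.log n * (Y - A) - (d + d * d) * n) ≤ Nat.card (Gdc n d c) := by
    rwa [Real.exp_sub, div_le_iff₀ (Real.exp_pos _)]
  refine hup.trans (le_trans ?_ (mul_le_mul_of_nonneg_left hlow' (Real.exp_pos _).le))
  rw [← Real.exp_add]
  refine Real.exp_le_exp.2 ?_
  have hlogn : Real.log n * A ≤ n * A :=
    mul_le_mul_of_nonneg_right (Real.log_le_self hn0'.le) hA0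
  have ht : Real.log n * (Real.log (Real.log n) / Real.log n * n / (6 * (d + 1))) =
      n * (Real.log (Real.log n) / (6 * (d + 1))) := by
    field_simp
  clear_value Y
  rw [mul_sub, ht, hC]
  linarith
end

section
/- Let G be a simple d-regular graph on n vertices with at least c·(n/3)·binom(d,2) triangles, where 0 < c < 1. Then the sum over all edges e of G of t_e/(t_e + 2) is at least c·(d·n/2)·(d-1)/(d+1). -/
/-- `t_e`: the number of triangles containing (both endpoints of) the edge `e`. -/
noncomputable def edgeTriCount {V : Type*} (G : SimpleGraph V) (e : Sym2 V) : ℕ :=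
  Nat.card {t : Finset V // G.IsNClique 3 t ∧ ∀ v ∈ e, v ∈ t}

section EdgeTriangles

variable {V : Type*} [Fintype V] [DecidableEq V] (G : SimpleGraph V) [DecidableRel G.Adj]

theorem card_isNClique_three_eq_card_cliqueFinset :
    Nat.card {t : Finset V // G.IsNClique 3 t} = (G.cliqueFinset 3).card := by
  rw [← Nat.card_eq_finsetCard]
  exact Nat.card_congr (Equiv.subtypeEquivRight fun t => by simp)

theorem edgeTriCount_eq_card_filter (e : Sym2 V) :
    edgeTriCount G e = ((G.cliqueFinset 3).filter fun t => ∀ v ∈ e, v ∈ t).card := by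
  rw [edgeTriCount, ← Nat.card_eq_finsetCard]
  exact Nat.card_congr (Equiv.subtypeEquivRight fun t => by simp)

/-- A triangle contains exactly three edges. -/
theorem card_edges_of_isNClique_three {t : Finset V} (ht : G.IsNClique 3 t) :
    (G.edgeFinset.filter fun e => ∀ v ∈ e, v ∈ t).card = 3 := by
  obtain ⟨a, b, c, hab, hac, hbc, rfl⟩ := SimpleGraph.is3Clique_iff.mp ht
  have h : (G.edgeFinset.filter fun e => ∀ v ∈ e, v ∈ ({a, b, c} : Finset V)) =
      {s(a, b), s(a, c), s(b, c)} := by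
    ext e
    induction e with
    | _ x y =>
      simp only [Finset.mem_filter, SimpleGraph.mem_edgeFinset, SimpleGraph.mem_edgeSet,
        Sym2.mem_iff, forall_eq_or_imp, forall_eq, Finset.mem_insert, Finset.mem_singleton,
        Sym2.eq_iff]
      constructor
      · rintro ⟨hxy, rfl | rfl | rfl, rfl | rfl | rfl⟩ <;> simp_all
      · rintro ((⟨rfl, rfl⟩ | ⟨rfl, rfl⟩) | (⟨rfl, rfl⟩ | ⟨rfl, rfl⟩) | (⟨rfl, rfl⟩ | ⟨rfl, rfl⟩)) <;>
          simp_all [G.adj_comm]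
  rw [h, Finset.card_eq_three]
  have := hab.ne
  have := hac.ne
  have := hbc.ne
  exact ⟨_, _, _, by grind, by grind, by grind, rfl⟩

/-- Counting pairs of an edge and a triangle containing it. -/
theorem sum_edgeTriCount :
    ∑ e ∈ G.edgeFinset, edgeTriCount G e = 3 * Nat.card {t : Finset V // G.IsNClique 3 t} := by
  simp_rw [edgeTriCount_eq_card_filter, card_isNClique_three_eq_card_cliqueFinset]
  have h := Finset.sum_card_bipartiteAbove_eq_sum_card_bipartiteBelow
    (s := G.edgeFinset) (t := G.cliqueFinset 3) fun (e : Sym2 V) t => ∀ v ∈ e, v ∈ t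
  refine h.trans ((Finset.sum_const_nat fun t ht => ?_).trans (mul_comm _ _))
  exact card_edges_of_isNClique_three G (G.mem_cliqueFinset_iff.mp ht)

/-- In a `d`-regular graph every edge lies in at most `d - 1` triangles. -/
theorem edgeTriCount_lt {d : ℕ} (hreg : IsDRegular G d) {e : Sym2 V} (he : e ∈ G.edgeFinset) :
    edgeTriCount G e < d := by
  induction e with
  | _ a b =>
    have hab : G.Adj a b := by simpa using he
    have hb : b ∈ G.neighborFinset a := by simpa using hab
    have hd : (G.neighborFinset a).card = d := by
      rw [← hreg a, Set.ncard_eq_toFinset_card', SimpleGraph.neighborFinset]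
    have hsub : ((G.cliqueFinset 3).filter fun t => ∀ v ∈ s(a, b), v ∈ t) ⊆
        ((G.neighborFinset a).erase b).image fun w => {a, b, w} := by
      intro t ht
      simp only [Finset.mem_filter, SimpleGraph.mem_cliqueFinset_iff, Sym2.mem_iff,
        forall_eq_or_imp, forall_eq] at ht
      obtain ⟨ht, hat, hbt⟩ := ht
      have hne := hab.ne
      obtain ⟨w, hw⟩ : ∃ w, (t.erase a).erase b = {w} := by
        rw [← Finset.card_eq_one, Finset.card_erase_of_mem (by grind),
          Finset.card_erase_of_mem hat, ht.card_eq]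
      have hwt : w ∈ (t.erase a).erase b := by simp [hw]
      simp only [Finset.mem_erase] at hwt
      have haw : G.Adj a w := ht.isClique hat hwt.2.2 (Ne.symm hwt.2.1)
      refine Finset.mem_image.mpr ⟨w, by simp [hwt.1, haw], ?_⟩
      rw [← hw, Finset.insert_erase (by grind), Finset.insert_erase hat]
    rw [edgeTriCount_eq_card_filter, ← hd]
    exact ((Finset.card_le_card hsub).trans Finset.card_image_le).trans_lt
      (Finset.card_erase_lt_of_mem hb)

end EdgeTriangles

/-- If a `d`-regular graph on `n` vertices has at least `c * (n/3) * choose d 2` triangles,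
then `∑_e t_e/(t_e+2) ≥ c (dn/2) (d-1)/(d+1)`. -/
theorem sum_edge_triangle_ratio (n d : ℕ) (c : ℝ) (hc0 : 0 < c) (hc1 : c < 1)
    (G : SimpleGraph (Fin n)) [DecidableRel G.Adj]
    (hreg : IsDRegular G d)
    (htri : c * ((n : ℝ) / 3 * (d.choose 2)) ≤
      (Nat.card {t : Finset (Fin n) // G.IsNClique 3 t} : ℝ)) :
    c * ((d : ℝ) * n / 2) * (((d : ℝ) - 1) / ((d : ℝ) + 1)) ≤
      ∑ e ∈ G.edgeFinset, (edgeTriCount G e : ℝ) / ((edgeTriCount G e : ℝ) + 2) := by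
  have hsum : ∑ e ∈ G.edgeFinset, (edgeTriCount G e : ℝ) =
      3 * (Nat.card {t : Finset (Fin n) // G.IsNClique 3 t} : ℝ) := by
    exact_mod_cast sum_edgeTriCount G
  have hle : ∑ e ∈ G.edgeFinset, (edgeTriCount G e : ℝ) / ((d : ℝ) + 1) ≤
      ∑ e ∈ G.edgeFinset, (edgeTriCount G e : ℝ) / ((edgeTriCount G e : ℝ) + 2) := by
    refine Finset.sum_le_sum fun e he => ?_
    have h : (edgeTriCount G e : ℝ) + 1 ≤ d := by exact_mod_cast edgeTriCount_lt G hreg he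
    exact div_le_div_of_nonneg_left (by positivity) (by positivity) (by linarith)
  refine le_trans ?_ hle
  rw [← Finset.sum_div, hsum, ← mul_div_assoc]
  rw [Nat.cast_choose_two] at htri
  exact div_le_div_of_nonneg_right (by linarith) (by positivity)
end

section
/- Let G be a simple d-regular graph, δ > 0, and let H₁, H₂ be dense spots of G with parameter δ. If H₁ ∩ H₂ ≠ ∅, then |H₁ ∩ H₂| ≥ (1 - 8δ)·d. -/
/-- A dense spot (with parameter `δ`) in a `d`-regular graph: a vertex set `H` with
`|H| ≤ d+1` such that every `x ∈ H` has at least `(1-4δ)d` neighbors inside `H`. -/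
def IsDenseSpot {V : Type*} (G : SimpleGraph V) (d : ℕ) (δ : ℝ) (H : Set V) : Prop :=
  H.ncard ≤ d + 1 ∧ ∀ x ∈ H, (1 - 4 * δ) * d ≤ ((H ∩ G.neighborSet x).ncard : ℝ)

/-- Two intersecting dense spots intersect in at least `(1-8δ)d` vertices. -/
theorem dense_spots_overlap {V : Type*} [Fintype V] (G : SimpleGraph V) (d : ℕ) (δ : ℝ)
    (hδ : 0 < δ) (hreg : IsDRegular G d) (H₁ H₂ : Set V)
    (h1 : IsDenseSpot G d δ H₁) (h2 : IsDenseSpot G d δ H₂)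
    (hne : (H₁ ∩ H₂).Nonempty) :
    (1 - 8 * δ) * d ≤ ((H₁ ∩ H₂).ncard : ℝ) := by
  obtain ⟨x, hx₁, hx₂⟩ := hne
  have hx := hreg x
  have hA := h1.2 x hx₁
  have hB := h2.2 x hx₂
  set N := G.neighborSet x
  have hsum := Set.ncard_union_add_ncard_inter (H₁ ∩ N) (H₂ ∩ N)
  have hunion : ((H₁ ∩ N) ∪ (H₂ ∩ N)).ncard ≤ d :=
    hx ▸ Set.ncard_le_ncard (Set.union_subset Set.inter_subset_right Set.inter_subset_right)
  have hinter : ((H₁ ∩ N) ∩ (H₂ ∩ N)).ncard ≤ (H₁ ∩ H₂).ncard :=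
    Set.ncard_le_ncard fun _ hy => ⟨hy.1.1, hy.2.1⟩
  have hcard : (H₁ ∩ N).ncard + (H₂ ∩ N).ncard ≤ d + (H₁ ∩ H₂).ncard := by omega
  have hcard' : ((H₁ ∩ N).ncard : ℝ) + (H₂ ∩ N).ncard ≤ d + (H₁ ∩ H₂).ncard := by
    exact_mod_cast hcard
  linarith
end

section
/- Let G be a simple d-regular graph and δ > 0 with (1 - 16δ)·d > 1, and let H₁, H₂, H₃ be dense spots of G with parameter δ. If H₁ ∩ H₂ ≠ ∅ and H₂ ∩ H₃ ≠ ∅, then H₁ ∩ H₃ ≠ ∅. -/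
/-- Inclusion-exclusion bound for two subsets of a common finite set. -/
lemma Set.ncard_add_ncard_le_of_subset {V : Type*} [Finite V] {A B C : Set V}
    (hA : A ⊆ C) (hB : B ⊆ C) : A.ncard + B.ncard ≤ C.ncard + (A ∩ B).ncard := by
  rw [← Set.ncard_union_add_ncard_inter A B]
  gcongr
  · exact Set.toFinite C
  · exact Set.union_subset hA hB

/-- Two dense spots that meet share at least `(1 - 8δ)d + 1` vertices. -/
lemma IsDenseSpot.le_ncard_inter {V : Type*} [Finite V] {G : SimpleGraph V} {d : ℕ} {δ : ℝ}
    (hreg : IsDRegular G d) {H K : Set V} (hH : IsDenseSpot G d δ H) (hK : IsDenseSpot G d δ K)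
    (hHK : (H ∩ K).Nonempty) : (1 - 8 * δ) * d + 1 ≤ ((H ∩ K).ncard : ℝ) := by
  obtain ⟨x, hxH, hxK⟩ := hHK
  have hN := Set.ncard_add_ncard_le_of_subset
    (Set.inter_subset_right : H ∩ G.neighborSet x ⊆ _)
    (Set.inter_subset_right : K ∩ G.neighborSet x ⊆ _)
  rw [hreg x, ← Set.inter_inter_distrib_right] at hN
  have hx : (H ∩ K ∩ G.neighborSet x).ncard + 1 ≤ (H ∩ K).ncard := by
    rw [← Set.ncard_insert_of_notMem (a := x) (by simp)]
    exact Set.ncard_le_ncard (Set.insert_subset ⟨hxH, hxK⟩ Set.inter_subset_left)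
  have h₁ := hH.2 x hxH
  have h₂ := hK.2 x hxK
  rify at hN hx
  linarith

/-- Intersection of dense spots is transitive when `(1-16δ)d > 1`. -/
theorem dense_spots_transitive {V : Type*} [Fintype V] (G : SimpleGraph V) (d : ℕ) (δ : ℝ)
    (hδ : 0 < δ) (hd : 1 < (1 - 16 * δ) * d) (hreg : IsDRegular G d)
    (H₁ H₂ H₃ : Set V)
    (h1 : IsDenseSpot G d δ H₁) (h2 : IsDenseSpot G d δ H₂) (h3 : IsDenseSpot G d δ H₃)
    (h12 : (H₁ ∩ H₂).Nonempty) (h23 : (H₂ ∩ H₃).Nonempty) :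
    (H₁ ∩ H₃).Nonempty := by
  have hle := Set.ncard_add_ncard_le_of_subset
    (Set.inter_subset_right : H₁ ∩ H₂ ⊆ H₂) (Set.inter_subset_left : H₂ ∩ H₃ ⊆ H₂)
  have h₁₂ := h1.le_ncard_inter hreg h2 h12
  have h₂₃ := h2.le_ncard_inter hreg h3 h23
  have h₂ := h2.1
  have hpos : 0 < ((H₁ ∩ H₂) ∩ (H₂ ∩ H₃)).ncard := by
    rify at hle h₂ ⊢
    linarith
  obtain ⟨x, hx₁₂, hx₂₃⟩ := Set.nonempty_of_ncard_ne_zero hpos.ne'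
  exact ⟨x, hx₁₂.1, hx₂₃.2⟩
end

section
/- Let G be a simple d-regular graph and δ > 0 with δ < 1/16 and δ·d ≥ 1. If K is a pseudo-clique of G with parameter δ, then |K| ≤ ((1 - 8δ)/(1 - 13δ))·(d+1). -/
/-- A pseudo-clique (with parameter `δ`): the union of the members of a maximal family of
pairwise-intersecting dense spots. -/
def IsPseudoClique {V : Type*} (G : SimpleGraph V) (d : ℕ) (δ : ℝ) (K : Set V) : Prop :=
  ∃ ℋ : Set (Set V),
    (∀ H ∈ ℋ, IsDenseSpot G d δ H) ∧
    (∀ H₁ ∈ ℋ, ∀ H₂ ∈ ℋ, (H₁ ∩ H₂).Nonempty) ∧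
    (∀ ℋ' : Set (Set V), ℋ ⊆ ℋ' → (∀ H ∈ ℋ', IsDenseSpot G d δ H) →
      (∀ H₁ ∈ ℋ', ∀ H₂ ∈ ℋ', (H₁ ∩ H₂).Nonempty) → ℋ' = ℋ) ∧
    K = ⋃₀ ℋ

/-- Two intersecting dense spots of a regular graph have a large intersection. -/
theorem IsDenseSpot.ncard_inter_ge {V : Type*} [Fintype V] {G : SimpleGraph V} {d : ℕ} {δ : ℝ}
    (hreg : IsDRegular G d) {A B : Set V} (hA : IsDenseSpot G d δ A) (hB : IsDenseSpot G d δ B)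
    (hAB : (A ∩ B).Nonempty) : (1 - 8 * δ) * d + 1 ≤ ((A ∩ B).ncard : ℝ) := by
  obtain ⟨x, hxA, hxB⟩ := hAB
  have h₁ := hA.2 x hxA
  have h₂ := hB.2 x hxB
  have hsum := Set.ncard_union_add_ncard_inter (A ∩ G.neighborSet x) (B ∩ G.neighborSet x)
  have hunion : ((A ∩ G.neighborSet x) ∪ (B ∩ G.neighborSet x)).ncard ≤ d := by
    rw [← hreg x]
    exact Set.ncard_le_ncard (Set.union_subset Set.inter_subset_right Set.inter_subset_right)
  have hinter : ((A ∩ G.neighborSet x) ∩ (B ∩ G.neighborSet x)).ncard + 1 ≤ (A ∩ B).ncard := by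
    rw [← Set.ncard_insert_of_notMem (a := x) (fun h => G.irrefl h.1.2)]
    refine Set.ncard_le_ncard (Set.insert_subset ⟨hxA, hxB⟩ fun y hy => ⟨hy.1.1, hy.2.1⟩)
  have hle : ((A ∩ G.neighborSet x).ncard : ℝ) + (B ∩ G.neighborSet x).ncard + 1
      ≤ d + (A ∩ B).ncard := by
    exact_mod_cast (by omega : (A ∩ G.neighborSet x).ncard + (B ∩ G.neighborSet x).ncard + 1
      ≤ d + (A ∩ B).ncard)
  linarith

/-- A vertex of a dense spot meeting the dense spot `A` has many neighbors in `A`. -/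
theorem IsDenseSpot.ncard_inter_neighborSet_ge {V : Type*} [Fintype V] {G : SimpleGraph V}
    {d : ℕ} {δ : ℝ} (hreg : IsDRegular G d) {A B : Set V} (hA : IsDenseSpot G d δ A)
    (hB : IsDenseSpot G d δ B) (hAB : (A ∩ B).Nonempty) {y : V} (hy : y ∈ B) :
    (1 - 12 * δ) * d ≤ ((A ∩ G.neighborSet y).ncard : ℝ) := by
  have h₁ := hB.2 y hy
  have h₂ := hA.ncard_inter_ge hreg hB hAB
  have hdiff := Set.ncard_inter_add_ncard_sdiff_eq_ncard B A
  rw [Set.inter_comm] at hdiff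
  have hsub : (B ∩ G.neighborSet y).ncard ≤ (A ∩ G.neighborSet y).ncard + (B \ A).ncard := by
    refine (Set.ncard_le_ncard fun z hz => ?_).trans (Set.ncard_union_le _ _)
    by_cases hzA : z ∈ A
    · exact Or.inl ⟨hzA, hz.2⟩
    · exact Or.inr ⟨hz.1, hzA⟩
  have hle : ((B ∩ G.neighborSet y).ncard : ℝ) + (A ∩ B).ncard
      ≤ (A ∩ G.neighborSet y).ncard + (d + 1) := by
    have := hB.1
    exact_mod_cast (by omega : (B ∩ G.neighborSet y).ncard + (A ∩ B).ncard
      ≤ (A ∩ G.neighborSet y).ncard + (d + 1))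
  linarith

/-- A vertex of a dense spot of a regular graph has few neighbors outside it. -/
theorem IsDenseSpot.ncard_neighborSet_diff_le {V : Type*} [Fintype V] {G : SimpleGraph V}
    {d : ℕ} {δ : ℝ} (hreg : IsDRegular G d) {A : Set V} (hA : IsDenseSpot G d δ A) {x : V}
    (hx : x ∈ A) : ((G.neighborSet x \ A).ncard : ℝ) ≤ 4 * δ * d := by
  have h₁ := hA.2 x hx
  have hdiff := Set.ncard_inter_add_ncard_sdiff_eq_ncard (G.neighborSet x) A
  rw [Set.inter_comm, hreg x] at hdiff
  have hdiff' : ((A ∩ G.neighborSet x).ncard : ℝ) + (G.neighborSet x \ A).ncard = d := by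
    exact_mod_cast hdiff
  linarith

/-- Double counting of the edges between two disjoint vertex sets. -/
theorem SimpleGraph.ncard_mul_le_ncard_mul {V : Type*} [Fintype V] (G : SimpleGraph V)
    {A B : Set V} (hAB : Disjoint B A) {m n : ℝ}
    (hm : ∀ y ∈ B, m ≤ ((A ∩ G.neighborSet y).ncard : ℝ))
    (hn : ∀ x ∈ A, ((G.neighborSet x \ A).ncard : ℝ) ≤ n) :
    (B.ncard : ℝ) * m ≤ A.ncard * n := by
  classical
  rw [Set.ncard_eq_toFinset_card', Set.ncard_eq_toFinset_card', ← nsmul_eq_mul, ← nsmul_eq_mul]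
  refine Finset.card_nsmul_le_card_nsmul G.Adj (fun y hy => ?_) (fun x hx => ?_)
  · refine (hm y (Set.mem_toFinset.1 hy)).trans (Nat.cast_le.2 ?_)
    rw [← Set.ncard_coe_finset]
    refine Set.ncard_le_ncard fun z hz => ?_
    simpa [Finset.bipartiteAbove] using hz
  · refine le_trans (Nat.cast_le.2 ?_) (hn x (Set.mem_toFinset.1 hx))
    rw [← Set.ncard_coe_finset]
    refine Set.ncard_le_ncard fun z hz => ?_
    simp only [Finset.bipartiteBelow, Finset.coe_filter, Set.mem_toFinset, Set.mem_ofPred_eq] at hz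
    exact ⟨hz.2.symm, Set.disjoint_left.1 hAB hz.1⟩

/-- A pseudo-clique has at most `((1-8δ)/(1-13δ)) (d+1)` vertices. -/
theorem pseudo_clique_size {V : Type*} [Fintype V] (G : SimpleGraph V) (d : ℕ) (δ : ℝ)
    (hδ0 : 0 < δ) (hδ : δ < 1 / 16) (hδd : 1 ≤ δ * d) (hreg : IsDRegular G d)
    (K : Set V) (hK : IsPseudoClique G d δ K) :
    (K.ncard : ℝ) ≤ (1 - 8 * δ) / (1 - 13 * δ) * ((d : ℝ) + 1) := by
  obtain ⟨ℋ, hdense, hinter, -, rfl⟩ := hK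
  have hd : (0 : ℝ) < d := by
    by_contra! h
    nlinarith
  rcases ℋ.eq_empty_or_nonempty with rfl | ⟨A, hA⟩
  · rw [Set.sUnion_empty, Set.ncard_empty, Nat.cast_zero]
    exact mul_nonneg (div_nonneg (by linarith) (by linarith)) (by linarith)
  have hcount := G.ncard_mul_le_ncard_mul (A := A) (B := ⋃₀ ℋ \ A) Set.disjoint_sdiff_left
    (m := (1 - 12 * δ) * d) (n := 4 * δ * d)
    (fun y ⟨⟨B, hB, hyB⟩, _⟩ =>
      (hdense A hA).ncard_inter_neighborSet_ge hreg (hdense B hB) (hinter A hA B hB) hyB)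
    (fun x hx => (hdense A hA).ncard_neighborSet_diff_le hreg hx)
  have hcard : ((⋃₀ ℋ).ncard : ℝ) = (⋃₀ ℋ \ A).ncard + A.ncard := by
    exact_mod_cast (Set.ncard_sdiff_add_ncard_of_subset (Set.subset_sUnion_of_mem hA)).symm
  have hAle : (A.ncard : ℝ) ≤ d + 1 := by exact_mod_cast (hdense A hA).1
  have hout : ((⋃₀ ℋ \ A).ncard : ℝ) * (1 - 12 * δ) ≤ A.ncard * (4 * δ) := by
    refine le_of_mul_le_mul_right ?_ hd
    linarith
  have hweak : ((⋃₀ ℋ).ncard : ℝ) ≤ (1 - 8 * δ) / (1 - 12 * δ) * ((d : ℝ) + 1) := by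
    rw [div_mul_eq_mul_div, le_div_iff₀ (by linarith), hcard]
    nlinarith
  refine hweak.trans (mul_le_mul_of_nonneg_right ?_ (by linarith))
  exact div_le_div_of_nonneg_left (by linarith) (by linarith) (by linarith)
end

section
/- Let G be a simple d-regular graph and δ > 0 with δ < 1/16 and δ·d ≥ 1. Let uv be an edge of G with t_{uv} ≥ d - δ·d, and suppose that each of u and v is incident to at most δ·d δ-bad edges. Then there exists a set H of vertices with u, v ∈ H, |H| ≤ d+1, and every vertex x ∈ H has at least (1-4δ)·d neighbors inside H; that is, the edge uv is contained in a dense spot with parameter δ. -/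
/-- An edge `e` is `δ`-bad if `1 ≤ t_e ≤ d - 1 - δd`. -/
def DeltaBad {V : Type*} (G : SimpleGraph V) (d : ℕ) (δ : ℝ) (e : Sym2 V) : Prop :=
  1 ≤ edgeTriCount G e ∧ (edgeTriCount G e : ℝ) ≤ (d : ℝ) - 1 - δ * d

/-- The triangles through an edge are counted by the common neighbors of its endpoints. -/
theorem edgeTriCount_eq_ncard_inter {V : Type*} [Finite V] (G : SimpleGraph V) {a b : V}
    (hab : G.Adj a b) :
    edgeTriCount G s(a, b) = (G.neighborSet a ∩ G.neighborSet b).ncard := by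
  classical
  rw [edgeTriCount, ← Nat.card_coe_set_eq]
  symm
  refine Nat.card_eq_of_bijective
    (fun c => ⟨{a, b, c.1}, ?_, ?_⟩) ⟨?_, ?_⟩
  · exact SimpleGraph.is3Clique_triple_iff.2 ⟨hab, c.2.1, c.2.2⟩
  · simp
  · rintro ⟨c, hac, hbc⟩ ⟨c', hac', hbc'⟩ h
    have h' : ({a, b, c} : Finset V) = {a, b, c'} := congrArg Subtype.val h
    have hc : c ∈ ({a, b, c'} : Finset V) := by simp [← h']
    have hac := G.ne_of_adj hac
    have hbc := G.ne_of_adj hbc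
    simp only [Finset.mem_insert, Finset.mem_singleton] at hc
    exact Subtype.ext (by grind)
  · rintro ⟨t, ht, hmem⟩
    have ha : a ∈ t := hmem a (by simp)
    have hb : b ∈ t := hmem b (by simp)
    have hb' : b ∈ t.erase a := Finset.mem_erase.2 ⟨hab.ne', hb⟩
    have hcard : ((t.erase a).erase b).card = 1 := by
      rw [Finset.card_erase_of_mem hb', Finset.card_erase_of_mem ha, ht.card_eq]
    obtain ⟨c, hc⟩ := Finset.card_eq_one.1 hcard
    have hct : c ∈ (t.erase a).erase b := by simp [hc]
    simp only [Finset.mem_erase] at hct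
    refine ⟨⟨c, ht.isClique ha hct.2.2 hct.2.1.symm, ht.isClique hb hct.2.2 hct.1.symm⟩, ?_⟩
    apply Subtype.ext
    change ({a, b, c} : Finset V) = t
    rw [← Finset.insert_erase ha, ← Finset.insert_erase hb', hc]

/-- There are at most as many neighbors joined to `u` by a bad edge as bad edges at `u`. -/
theorem ncard_bad_neighbors_le {V : Type*} [Finite V] (G : SimpleGraph V) (d : ℕ) (δ : ℝ) (u : V) :
    {x | G.Adj u x ∧ DeltaBad G d δ s(u, x)}.ncard ≤
      Nat.card {e : Sym2 V // e ∈ G.edgeSet ∧ u ∈ e ∧ DeltaBad G d δ e} := by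
  rw [← Nat.card_coe_set_eq]
  refine Nat.card_le_card_of_injective
    (fun x => ⟨s(u, x.1), x.2.1, Sym2.mem_mk_left u x.1, x.2.2⟩) ?_
  intro x y h
  exact Subtype.ext (Sym2.congr_right.1 (congrArg Subtype.val h))

/-- A good edge between two good vertices lies in a dense spot: if `uv` is an edge with
`t_{uv} ≥ d - δd`, and each of `u` and `v` is incident to at most `δd` `δ`-bad edges, then
there is a dense spot (with parameter `δ`) containing both `u` and `v`. -/
theorem good_edge_in_dense_spot {V : Type*} [Fintype V] (G : SimpleGraph V) (d : ℕ)
    (δ : ℝ) (hδ0 : 0 < δ) (hδ : δ < 1 / 16) (hδd : 1 ≤ δ * d) (hreg : IsDRegular G d)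
    (u v : V) (huv : G.Adj u v)
    (htuv : (d : ℝ) - δ * d ≤ (edgeTriCount G s(u, v) : ℝ))
    (hu : (Nat.card {e : Sym2 V // e ∈ G.edgeSet ∧ u ∈ e ∧ DeltaBad G d δ e} : ℝ) ≤ δ * d)
    (hv : (Nat.card {e : Sym2 V // e ∈ G.edgeSet ∧ v ∈ e ∧ DeltaBad G d δ e} : ℝ) ≤ δ * d) :
    ∃ H : Set V, u ∈ H ∧ v ∈ H ∧ IsDenseSpot G d δ H := by
  set C := G.neighborSet u ∩ G.neighborSet v with hC
  set B := {x | G.Adj u x ∧ DeltaBad G d δ s(u, x)} with hB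
  have hC_card : (d : ℝ) - δ * d ≤ C.ncard := by
    rwa [edgeTriCount_eq_ncard_inter G huv] at htuv
  have hB_card : (B.ncard : ℝ) ≤ δ * d :=
    (Nat.cast_le.2 (ncard_bad_neighbors_le G d δ u)).trans hu
  have hCB : (C.ncard : ℝ) ≤ (C \ B).ncard + B.ncard := by
    exact_mod_cast Set.ncard_le_ncard_sdiff_add_ncard C B
  have hvD : v ∉ C \ B := fun h => G.loopless.irrefl v h.1.2
  have hK_card : (insert v (C \ B)).ncard = (C \ B).ncard + 1 := Set.ncard_insert_of_notMem hvD
  have hK_sub : insert v (C \ B) ⊆ G.neighborSet u :=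
    Set.insert_subset huv fun x hx => hx.1.1
  refine ⟨insert u (insert v (C \ B)), by simp, by simp, ?_, ?_⟩
  · calc (insert u (insert v (C \ B))).ncard
      _ ≤ (insert v (C \ B)).ncard + 1 := Set.ncard_insert_le _ _
      _ ≤ (G.neighborSet u).ncard + 1 := by gcongr; exact Set.toFinite _
      _ = d + 1 := by rw [hreg u]
  · rintro x (rfl | rfl | hx)
    · have h : C \ B ⊆ insert x (insert v (C \ B)) ∩ G.neighborSet x :=
        fun y hy => ⟨by simp [hy], hy.1.1⟩
      have h' : ((C \ B).ncard : ℝ) ≤ (insert x (insert v (C \ B)) ∩ G.neighborSet x).ncard :=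
        Nat.cast_le.2 (Set.ncard_le_ncard h)
      linarith
    · have h : C \ B ⊆ insert u (insert x (C \ B)) ∩ G.neighborSet x :=
        fun y hy => ⟨by simp [hy], hy.1.2⟩
      have h' : ((C \ B).ncard : ℝ) ≤ (insert u (insert x (C \ B)) ∩ G.neighborSet x).ncard :=
        Nat.cast_le.2 (Set.ncard_le_ncard h)
      linarith
    · have hux : G.Adj u x := hx.1.1
      have htri := edgeTriCount_eq_ncard_inter G hux
      have hpos : 1 ≤ edgeTriCount G s(u, x) := by
        rw [htri, Nat.succ_le_iff, Set.ncard_pos]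
        exact ⟨v, huv, hx.1.2.symm⟩
      have hgood : (d : ℝ) - 1 - δ * d < edgeTriCount G s(u, x) :=
        lt_of_not_ge fun h => hx.2 ⟨hux, hpos, h⟩
      rw [htri] at hgood
      have hsub : G.neighborSet u ∩ G.neighborSet x ⊆
          (insert u (insert v (C \ B)) ∩ G.neighborSet x) ∪
            (G.neighborSet u \ insert v (C \ B)) := by
        intro y hy
        by_cases h : y ∈ insert v (C \ B)
        · exact Or.inl ⟨Or.inr h, hy.2⟩
        · exact Or.inr ⟨hy.1, h⟩
      have h1 : ((G.neighborSet u ∩ G.neighborSet x).ncard : ℝ) ≤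
          (insert u (insert v (C \ B)) ∩ G.neighborSet x).ncard +
            (G.neighborSet u \ insert v (C \ B)).ncard := by
        exact_mod_cast (Set.ncard_le_ncard hsub).trans (Set.ncard_union_le _ _)
      have h2 : ((G.neighborSet u \ insert v (C \ B)).ncard : ℝ) + ((C \ B).ncard + 1) = d := by
        have := Set.ncard_sdiff_add_ncard_of_subset hK_sub
        rw [hK_card, hreg u] at this
        exact_mod_cast this
      linarith
end
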